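/- arXiv:2312.08893 — 3 statements merged into one kernel-verified Lean document; each statement's English description precedes it below -/
import Mathlib

section
/- Let A be a real m×n matrix of rank r, and let λ₁ ≥ λ₂ ≥ … ≥ λ_m ≥ 0 be the eigenvalues of B = A·Aᵀ (so λ_i > 0 exactly when i ≤ r). Let k and k' be integers with 1 ≤ k < k' < r. Define the n×n matrix N := Σ_{S ⊆ {1,…,m}, |S| = k'} (A_{S,:})ᵀ · adj(B_{S,S}) · A_{S,:} and the scalar D := Σ_{S ⊆ {1,…,m}, |S| = k'} det(B_{S,S}). Then D > 0, and for every vector w ∈ ℝⁿ lying in the row space of A (i.e., in the range of Aᵀ) one has wᵀ N w ≥ D · (k'−k) / (k'−k−1 + Σ_{j=k+1}^{r} λ_j/λ_r) · ‖w‖². (This is the statement that the smallest positive eigenvalue of the expected projection E[P_S] = N/D under k'-DPP(AAᵀ) sampling is at least (k'−k)/(k'−k−1+(r−k)·κ̄_k²), where κ̄_k² = (1/(r−k))·Σ_{j=k+1}^r λ_j/λ_r.) -/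
open Matrix

/-- The row submatrix `A_{S,:}` of `A` given by the rows indexed by `S`. -/
def rowSub {m n : ℕ} (A : Matrix (Fin m) (Fin n) ℝ) (S : Finset (Fin m)) :
    Matrix {x // x ∈ S} (Fin n) ℝ :=
  A.submatrix (fun i => (i : Fin m)) id

/-- The adjugate `adj(M_{S,S})` of the principal submatrix of `M` indexed by `S`. -/
noncomputable def principalAdj {m : ℕ} (M : Matrix (Fin m) (Fin m) ℝ)
    (S : Finset (Fin m)) : Matrix {x // x ∈ S} {x // x ∈ S} ℝ :=
  (M.submatrix (fun i : {x // x ∈ S} => (i : Fin m)) (fun i : {x // x ∈ S} => (i : Fin m))).adjugate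

/-- The principal minor `det(M_{S,S})`. -/
noncomputable def principalMinor {m : ℕ} (M : Matrix (Fin m) (Fin m) ℝ)
    (S : Finset (Fin m)) : ℝ :=
  (M.submatrix (fun i : {x // x ∈ S} => (i : Fin m)) (fun i : {x // x ∈ S} => (i : Fin m))).det

/-- The matrix determinant lemma, without an invertibility assumption. -/
theorem det_add_vecMulVec {ι : Type*} [Fintype ι] [DecidableEq ι] (M : Matrix ι ι ℝ)
    (u v : ι → ℝ) : (M + vecMulVec u v).det = M.det + v ⬝ᵥ (M.adjugate *ᵥ u) := by
  have hunit : ∀ M : Matrix ι ι ℝ, M.det ≠ 0 →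
      (M + vecMulVec u v).det = M.det + v ⬝ᵥ (M.adjugate *ᵥ u) := by
    intro M hM
    rw [vecMulVec_eq Unit, det_add_replicateCol_mul_replicateRow hM.isUnit,
      det_unique (n := Unit), Matrix.add_apply, one_apply_eq, Matrix.mul_assoc,
      ← replicateCol_mulVec, replicateRow_mul_replicateCol_apply, inv_def, smul_mulVec,
      dotProduct_smul, smul_eq_mul, mul_add, mul_one, Ring.inverse_eq_inv,
      mul_inv_cancel_left₀ hM]
  have hdense : Dense {t : ℝ | (scalar ι t + M).det ≠ 0} := by
    have : {t : ℝ | (scalar ι t + M).det ≠ 0} = ((-M).charpoly.rootSet ℝ)ᶜ := by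
      ext t
      simp [Polynomial.mem_rootSet, (charpoly_monic (-M)).ne_zero, eval_charpoly]
    rw [this]
    exact (Set.toFinite _).countable.dense_compl ℝ
  have key := Continuous.ext_on hdense
    (f := fun t : ℝ => (scalar ι t + M + vecMulVec u v).det)
    (g := fun t : ℝ => (scalar ι t + M).det + v ⬝ᵥ ((scalar ι t + M).adjugate *ᵥ u))
    (by simp only [scalar_apply]; fun_prop) (by simp only [scalar_apply]; fun_prop)
    (fun t ht => hunit _ ht)
  simpa using congrFun key 0

/-- The sum of the principal minors of a given order is invariant under similarity. -/
theorem sum_principalMinor_conj {m : ℕ} (M Q : Matrix (Fin m) (Fin m) ℝ) (hQ : Qᵀ * Q = 1)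
    {q : ℕ} (hq : q ≤ m) :
    ∑ S ∈ Finset.powersetCard q Finset.univ, principalMinor (Q * M * Qᵀ) S =
      ∑ S ∈ Finset.powersetCard q Finset.univ, principalMinor M S := by
  have h1 := charpoly_coeff_eq_sum_minors (Q * M * Qᵀ) q (by simpa using hq)
  have h2 := charpoly_coeff_eq_sum_minors M q (by simpa using hq)
  rw [Matrix.mul_assoc, charpoly_mul_comm, Matrix.mul_assoc, hQ, Matrix.mul_one, h2,
    ← Matrix.mul_assoc] at h1
  exact (mul_left_cancel₀ (pow_ne_zero _ (by norm_num)) h1).symm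

theorem principalMinor_add_vecMulVec {m : ℕ} (M : Matrix (Fin m) (Fin m) ℝ) (y : Fin m → ℝ)
    (S : Finset (Fin m)) :
    principalMinor (M + vecMulVec y y) S = principalMinor M S +
      (fun i : S => y i) ⬝ᵥ (principalAdj M S *ᵥ fun i : S => y i) :=
  det_add_vecMulVec _ _ _

theorem principalMinor_diagonal {m : ℕ} (L : Fin m → ℝ) (S : Finset (Fin m)) :
    principalMinor (diagonal L) S = ∏ i ∈ S, L i := by
  rw [principalMinor, submatrix_diagonal _ _ Subtype.val_injective, det_diagonal]
  exact Finset.prod_coe_sort S L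

theorem dotProduct_principalAdj_diagonal {m : ℕ} (L z : Fin m → ℝ) (S : Finset (Fin m)) :
    (fun i : S => z i) ⬝ᵥ (principalAdj (diagonal L) S *ᵥ fun i : S => z i) =
      ∑ i ∈ S, z i ^ 2 * ∏ j ∈ S.erase i, L j := by
  rw [principalAdj, submatrix_diagonal _ _ Subtype.val_injective, adjugate_diagonal,
    ← Finset.sum_coe_sort S]
  refine Finset.sum_congr rfl fun i _ => ?_
  have : ∏ j ∈ Finset.univ.erase i, L (j : Fin m) = ∏ j ∈ S.erase i, L j := by
    refine Finset.prod_bij (fun j _ => (j : Fin m)) ?_ ?_ ?_ ?_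
    · intro a ha
      rw [Finset.mem_erase] at ha ⊢
      exact ⟨fun h => ha.1 (Subtype.ext h), a.2⟩
    · intro a _ b _ h
      exact Subtype.ext h
    · intro b hb
      exact ⟨⟨b, Finset.mem_of_mem_erase hb⟩, by
        simpa [Subtype.ext_iff] using Finset.ne_of_mem_erase hb, rfl⟩
    · intros; rfl
  simp only [mulVec_diagonal, Function.comp_apply, this]
  ring

/-- Exchanging `i` and `j` in the index sets of an elementary symmetric sum. -/
theorem mul_sum_prod_exchange {ι : Type*} [Fintype ι] [DecidableEq ι] (L : ι → ℝ) (q : ℕ)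
    {i j : ι} (hij : i ≠ j) :
    L i * ∑ S ∈ Finset.powersetCard q Finset.univ with i ∉ S ∧ j ∈ S, ∏ l ∈ S, L l =
      L j * ∑ S ∈ Finset.powersetCard q Finset.univ with j ∉ S ∧ i ∈ S, ∏ l ∈ S, L l := by
  have hcard : ∀ S : Finset ι, ∀ i j, i ∉ S → j ∈ S → (insert i (S.erase j)).card = S.card := by
    intro S i j hi hj
    rw [Finset.card_insert_of_notMem (by simp [hi]), Finset.card_erase_add_one hj]
  rw [Finset.mul_sum, Finset.mul_sum]
  refine Finset.sum_nbij' (fun S => insert i (S.erase j)) (fun S => insert j (S.erase i))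
    ?_ ?_ ?_ ?_ ?_
  · intro S hS
    simp only [Finset.mem_filter, Finset.mem_powersetCard_univ] at hS ⊢
    refine ⟨by rw [hcard S i j hS.2.1 hS.2.2, hS.1], ?_⟩
    simp [hij.symm]
  · intro S hS
    simp only [Finset.mem_filter, Finset.mem_powersetCard_univ] at hS ⊢
    refine ⟨by rw [hcard S j i hS.2.1 hS.2.2, hS.1], ?_⟩
    simp [hij]
  · intro S hS
    simp only [Finset.mem_filter] at hS
    rw [Finset.erase_insert (by simp [hS.2.1]), Finset.insert_erase hS.2.2]
  · intro S hS
    simp only [Finset.mem_filter] at hS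
    rw [Finset.erase_insert (by simp [hS.2.1]), Finset.insert_erase hS.2.2]
  · intro S hS
    simp only [Finset.mem_filter] at hS
    rw [Finset.prod_insert (by simp [hS.2.1]), ← Finset.mul_prod_erase S L hS.2.2]
    ring

/-- If at most `k` indices other than `i` with `L ≠ 0` lie outside `J`, the terms of the elementary
symmetric sum avoiding `i` are controlled by those containing `i`. -/
theorem mul_sum_prod_notMem_le {ι : Type*} [Fintype ι] [DecidableEq ι] (L : ι → ℝ)
    (hL : ∀ i, 0 ≤ L i) (q k : ℕ) (i : ι) (J : Finset ι) (hi : i ∉ J)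
    (hk : ({l | l ≠ i ∧ l ∉ J ∧ L l ≠ 0} : Finset ι).card ≤ k) :
    L i * (((q : ℝ) - k) * ∑ S ∈ Finset.powersetCard q Finset.univ with i ∉ S, ∏ l ∈ S, L l) ≤
      (∑ j ∈ J, L j) * ∑ S ∈ Finset.powersetCard q Finset.univ with i ∈ S, ∏ l ∈ S, L l := by
  have hprod : ∀ S : Finset ι, 0 ≤ ∏ l ∈ S, L l := fun S => Finset.prod_nonneg fun l _ => hL l
  have hcount : ((q : ℝ) - k) *
      ∑ S ∈ Finset.powersetCard q Finset.univ with i ∉ S, ∏ l ∈ S, L l ≤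
      ∑ j ∈ J, ∑ S ∈ Finset.powersetCard q Finset.univ with i ∉ S ∧ j ∈ S, ∏ l ∈ S, L l := by
    have hswap : ∑ j ∈ J, ∑ S ∈ Finset.powersetCard q Finset.univ with i ∉ S ∧ j ∈ S,
        ∏ l ∈ S, L l =
        ∑ S ∈ Finset.powersetCard q Finset.univ with i ∉ S,
          ((S ∩ J).card : ℝ) * ∏ l ∈ S, L l := by
      simp_rw [← Finset.filter_filter]
      simp_rw [Finset.sum_filter (fun S : Finset ι => _ ∈ S)]
      rw [Finset.sum_comm]
      refine Finset.sum_congr rfl fun S _ => ?_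
      rw [← Finset.sum_filter, Finset.sum_const, nsmul_eq_mul, Finset.filter_mem_eq_inter,
        Finset.inter_comm]
    rw [hswap, Finset.mul_sum]
    refine Finset.sum_le_sum fun S hS => ?_
    simp only [Finset.mem_filter, Finset.mem_powersetCard_univ] at hS
    rcases eq_or_ne (∏ l ∈ S, L l) 0 with h0 | h0
    · simp [h0]
    refine mul_le_mul_of_nonneg_right ?_ (hprod S)
    have hsub : S \ J ⊆ ({l | l ≠ i ∧ l ∉ J ∧ L l ≠ 0} : Finset ι) := by
      intro l hl
      rw [Finset.mem_sdiff] at hl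
      simp only [Finset.mem_filter, Finset.mem_univ, true_and]
      exact ⟨fun h => hS.2 (h ▸ hl.1), hl.2, Finset.prod_ne_zero_iff.1 h0 l hl.1⟩
    have h1 := (Finset.card_le_card hsub).trans hk
    have h2 := Finset.card_sdiff_add_card_inter S J
    have h3 : q ≤ k + (S ∩ J).card := by omega
    have h4 : (q : ℝ) ≤ k + (S ∩ J).card := by exact_mod_cast h3
    linarith
  refine (mul_le_mul_of_nonneg_left hcount (hL i)).trans ?_
  rw [Finset.mul_sum, Finset.sum_mul]
  refine Finset.sum_le_sum fun j hj => ?_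
  rw [mul_sum_prod_exchange L q (fun h : i = j => hi (h ▸ hj))]
  refine mul_le_mul_of_nonneg_left ?_ (hL j)
  refine Finset.sum_le_sum_of_subset_of_nonneg ?_ fun S _ _ => hprod S
  intro S hS
  simp only [Finset.mem_filter] at hS ⊢
  exact ⟨hS.1, hS.2.2⟩

/-- For an antitone spectrum with exactly `r` positive entries, the marginal weight of any positive
entry in the elementary symmetric sum of degree `q`. -/
theorem esymm_mul_le_sum_mem {m r k q : ℕ} (lam : ℕ → ℝ) (hrm : r ≤ m)
    (hmono : ∀ i j : ℕ, 1 ≤ i → i ≤ j → j ≤ m → lam j ≤ lam i)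
    (hnonneg : ∀ i : ℕ, 1 ≤ i → i ≤ m → 0 ≤ lam i)
    (hpos : ∀ i : ℕ, 1 ≤ i → i ≤ m → (0 < lam i ↔ i ≤ r))
    (hkq : k < q) (hqr : q < r) (i : Fin m) (hir : (i : ℕ) < r) :
    (∑ S ∈ Finset.powersetCard q (Finset.univ : Finset (Fin m)), ∏ l ∈ S, lam (l + 1)) *
        (((q : ℝ) - k) / (((q : ℝ) - k) - 1 + ∑ j ∈ Finset.Icc (k + 1) r, lam j / lam r)) ≤
      ∑ S ∈ Finset.powersetCard q (Finset.univ : Finset (Fin m)) with i ∈ S,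
        ∏ l ∈ S, lam (l + 1) := by
  set L : Fin m → ℝ := fun l => lam (l + 1) with hLdef
  have hL : ∀ l, 0 ≤ L l := fun l => hnonneg _ (by omega) (by omega)
  have hL0 : ∀ l : Fin m, L l ≠ 0 → (l : ℕ) < r := fun l h =>
    (hpos (l + 1) (by omega) (by omega)).1 (lt_of_le_of_ne (hL l) h.symm)
  have hr0 : 0 < lam r := (hpos r (by omega) hrm).2 le_rfl
  have hLr : ∀ l : Fin m, (l : ℕ) < r → lam r ≤ L l := fun l hl =>
    hmono _ _ (by omega) (by omega) hrm
  let I : Finset (Fin m) := {l | k ≤ (l : ℕ) ∧ (l : ℕ) < r}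
  have hI : ∑ j ∈ Finset.Icc (k + 1) r, lam j / lam r = (∑ l ∈ I, L l) / lam r := by
    rw [Finset.sum_div]
    symm
    refine Finset.sum_bij (fun l _ => (l : ℕ) + 1) ?_ ?_ ?_ ?_
    · intro l hl
      simp only [I, Finset.mem_filter, Finset.mem_univ, true_and] at hl
      simp only [Finset.mem_Icc]
      omega
    · intro a _ b _ h
      exact Fin.ext (by omega)
    · intro b hb
      rw [Finset.mem_Icc] at hb
      refine ⟨⟨b - 1, by omega⟩, ?_, by simp only; omega⟩
      simp only [I, Finset.mem_filter, Finset.mem_univ, true_and]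
      omega
    · intros; rfl
  obtain ⟨p, hpI, hpi, hcard⟩ : ∃ p ∈ I, i ∉ I.erase p ∧
      ({l | l ≠ i ∧ l ∉ I.erase p ∧ L l ≠ 0} : Finset (Fin m)).card ≤ k := by
    let K : Finset (Fin m) := {l | (l : ℕ) < k}
    have hK : K.card = k := by
      simp only [K]
      rw [Fin.card_filter_val_lt]
      omega
    rcases lt_or_ge (i : ℕ) k with hik | hik
    · let p : Fin m := ⟨r - 1, by omega⟩
      refine ⟨p, ?_, ?_, ?_⟩
      · simp only [I, p, Finset.mem_filter, Finset.mem_univ, true_and]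
        omega
      · simp only [I, Finset.mem_erase, Finset.mem_filter, Finset.mem_univ, true_and]
        omega
      · have hsub : ({l | l ≠ i ∧ l ∉ I.erase p ∧ L l ≠ 0} : Finset (Fin m)) ⊆
            insert p (K.erase i) := by
          intro l hl
          simp only [I, K, Finset.mem_filter, Finset.mem_univ, true_and, Finset.mem_erase,
            Finset.mem_insert] at hl ⊢
          have := hL0 l hl.2.2
          by_cases hlp : l = p
          · exact Or.inl hlp
          · refine Or.inr ⟨hl.1, ?_⟩
            by_contra hlk
            exact hl.2.1 ⟨hlp, by omega, this⟩
        have hiK : i ∈ K := by simpa [K] using hik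
        have h1 := Finset.card_le_card hsub
        have h2 := Finset.card_insert_le p (K.erase i)
        have h3 := Finset.card_erase_add_one hiK
        omega
    · refine ⟨i, ?_, Finset.notMem_erase _ _, ?_⟩
      · simp only [I, Finset.mem_filter, Finset.mem_univ, true_and]
        exact ⟨hik, hir⟩
      · rw [← hK]
        refine Finset.card_le_card fun l hl => ?_
        simp only [I, K, Finset.mem_filter, Finset.mem_univ, true_and, Finset.mem_erase] at hl ⊢
        have := hL0 l hl.2.2
        by_contra hlk
        exact hl.2.1 ⟨hl.1, by omega, this⟩
  have hpr : lam r ≤ L p := by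
    simp only [I, Finset.mem_filter, Finset.mem_univ, true_and] at hpI
    exact hLr p hpI.2
  have key := mul_sum_prod_notMem_le L hL q k i (I.erase p) hpi hcard
  have hsplit := Finset.sum_filter_add_sum_filter_not
    (Finset.powersetCard q (Finset.univ : Finset (Fin m))) (fun S => i ∈ S)
    (fun S => ∏ l ∈ S, L l)
  have herase := Finset.add_sum_erase I L hpI
  rw [hI]
  change (∑ S ∈ Finset.powersetCard q (Finset.univ : Finset (Fin m)), ∏ l ∈ S, L l) * _ ≤
    ∑ S ∈ Finset.powersetCard q (Finset.univ : Finset (Fin m)) with i ∈ S, ∏ l ∈ S, L l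
  rw [← hsplit]
  have hprod : ∀ S : Finset (Fin m), 0 ≤ ∏ l ∈ S, L l := fun S =>
    Finset.prod_nonneg fun l _ => hL l
  have hPin := Finset.sum_nonneg fun S
    (_ : S ∈ {S ∈ Finset.powersetCard q (Finset.univ : Finset (Fin m)) | i ∈ S}) => hprod S
  have hPout := Finset.sum_nonneg fun S
    (_ : S ∈ {S ∈ Finset.powersetCard q (Finset.univ : Finset (Fin m)) | i ∉ S}) => hprod S
  set Pin := ∑ S ∈ Finset.powersetCard q (Finset.univ : Finset (Fin m)) with i ∈ S, ∏ l ∈ S, L l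
  set Pout := ∑ S ∈ Finset.powersetCard q (Finset.univ : Finset (Fin m)) with i ∉ S, ∏ l ∈ S, L l
  have hJ : 0 ≤ ∑ l ∈ I.erase p, L l := Finset.sum_nonneg fun l _ => hL l
  have hd : (1 : ℝ) ≤ (q : ℝ) - k := by
    have : ((k + 1 : ℕ) : ℝ) ≤ q := by exact_mod_cast hkq
    push_cast at this
    linarith
  have hσ : 1 + (∑ l ∈ I.erase p, L l) / lam r ≤ (∑ l ∈ I, L l) / lam r := by
    rw [← herase, add_div]
    gcongr
    rwa [one_le_div hr0]
  have hout : ((q : ℝ) - k) * Pout ≤ (∑ l ∈ I.erase p, L l) / lam r * Pin := by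
    rw [div_mul_eq_mul_div, le_div_iff₀ hr0]
    refine le_trans ?_ key
    rw [mul_comm]
    exact mul_le_mul_of_nonneg_right (hLr i hir) (mul_nonneg (by linarith) hPout)
  have hden : 0 < (q : ℝ) - k - 1 + (∑ l ∈ I, L l) / lam r := by
    have : 0 ≤ (∑ l ∈ I.erase p, L l) / lam r := div_nonneg hJ hr0.le
    linarith
  rw [← mul_div_assoc, div_le_iff₀ hden]
  nlinarith [mul_le_mul_of_nonneg_right hσ hPin]

/-- The quadratic form of `∑ S, A_Sᵀ adj(B_S) A_S` in the eigenbasis of `B = A Aᵀ`. -/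
theorem dotProduct_sum_rowSub_mulVec {m n q : ℕ} (A : Matrix (Fin m) (Fin n) ℝ) (L : Fin m → ℝ)
    (Q : Matrix (Fin m) (Fin m) ℝ) (hQ : Qᵀ * Q = 1) (hB : A * Aᵀ = Q * diagonal L * Qᵀ)
    (hq : q ≤ m) (w : Fin n → ℝ) (z : Fin m → ℝ) (hz : A *ᵥ w = Q *ᵥ z) :
    w ⬝ᵥ ((∑ S ∈ Finset.powersetCard q (Finset.univ : Finset (Fin m)),
        (rowSub A S)ᵀ * principalAdj (A * Aᵀ) S * rowSub A S) *ᵥ w) =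
      ∑ S ∈ Finset.powersetCard q (Finset.univ : Finset (Fin m)),
        ∑ i ∈ S, z i ^ 2 * ∏ j ∈ S.erase i, L j := by
  have hterm : ∀ S : Finset (Fin m),
      w ⬝ᵥ (((rowSub A S)ᵀ * principalAdj (A * Aᵀ) S * rowSub A S) *ᵥ w) =
        (fun i : S => (A *ᵥ w) i) ⬝ᵥ (principalAdj (A * Aᵀ) S *ᵥ fun i : S => (A *ᵥ w) i) := by
    intro S
    rw [← mulVec_mulVec, ← mulVec_mulVec, dotProduct_mulVec, vecMul_transpose]
    rfl
  have hconj : A * Aᵀ + vecMulVec (A *ᵥ w) (A *ᵥ w) =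
      Q * (diagonal L + vecMulVec z z) * Qᵀ := by
    rw [hB, hz, Matrix.mul_add, Matrix.add_mul, mul_vecMulVec, vecMulVec_mul, vecMul_transpose]
  have h1 := sum_principalMinor_conj (diagonal L + vecMulVec z z) Q hQ hq
  have h2 := sum_principalMinor_conj (diagonal L) Q hQ hq
  rw [← hconj] at h1
  rw [← hB] at h2
  simp only [principalMinor_add_vecMulVec, Finset.sum_add_distrib,
    dotProduct_principalAdj_diagonal, h2] at h1
  rw [sum_mulVec, dotProduct_sum]
  simp only [hterm]
  exact add_left_cancel h1

/-- improved expected-projection bound under k'-DPP sampling: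
let `A` be a real `m × n` matrix of rank `r`, and let `λ₁ ≥ … ≥ λ_m ≥ 0` be the
eigenvalues of `B = A·Aᵀ` (1-based indices, expressed via an orthogonal
eigendecomposition; `λ_i > 0` exactly when `i ≤ r`). Let `1 ≤ k < k' < r`. With
`N := Σ_{|S| = k'} (A_{S,:})ᵀ · adj(B_{S,S}) · A_{S,:}` and
`D := Σ_{|S| = k'} det(B_{S,S})`, we have `D > 0`, and every `w` in the range of `Aᵀ`
satisfies `wᵀ N w ≥ D · (k'−k)/(k'−k−1 + Σ_{j=k+1}^r λ_j/λ_r) · ‖w‖²`. -/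
theorem stmt0 {m n r : ℕ} (A : Matrix (Fin m) (Fin n) ℝ) (hr : A.rank = r)
    (lam : ℕ → ℝ) (Q : Matrix (Fin m) (Fin m) ℝ) (hQ : Qᵀ * Q = 1)
    (hB : A * Aᵀ = Q * Matrix.diagonal (fun i : Fin m => lam ((i : ℕ) + 1)) * Qᵀ)
    (hmono : ∀ i j : ℕ, 1 ≤ i → i ≤ j → j ≤ m → lam j ≤ lam i)
    (hnonneg : ∀ i : ℕ, 1 ≤ i → i ≤ m → 0 ≤ lam i)
    (hpos : ∀ i : ℕ, 1 ≤ i → i ≤ m → (0 < lam i ↔ i ≤ r))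
    (k k' : ℕ) (hk : 1 ≤ k) (hkk' : k < k') (hk'r : k' < r) :
    0 < (∑ S ∈ Finset.powersetCard k' (Finset.univ : Finset (Fin m)),
          principalMinor (A * Aᵀ) S) ∧
      ∀ w : Fin n → ℝ, (∃ v : Fin m → ℝ, w = Aᵀ *ᵥ v) →
        (∑ S ∈ Finset.powersetCard k' (Finset.univ : Finset (Fin m)),
              principalMinor (A * Aᵀ) S) *
            (((k' : ℝ) - k) /
              (((k' : ℝ) - k) - 1 + ∑ j ∈ Finset.Icc (k + 1) r, lam j / lam r)) *
            (w ⬝ᵥ w)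
          ≤ w ⬝ᵥ ((∑ S ∈ Finset.powersetCard k' (Finset.univ : Finset (Fin m)),
              (rowSub A S)ᵀ * principalAdj (A * Aᵀ) S * rowSub A S) *ᵥ w) := by
  have hrm : r ≤ m := hr ▸ A.rank_le_height
  set L : Fin m → ℝ := fun i => lam ((i : ℕ) + 1) with hLdef
  have hL : ∀ l, 0 ≤ L l := fun l => hnonneg _ (by omega) (by omega)
  have hD : ∑ S ∈ Finset.powersetCard k' (Finset.univ : Finset (Fin m)),
      principalMinor (A * Aᵀ) S =
      ∑ S ∈ Finset.powersetCard k' (Finset.univ : Finset (Fin m)), ∏ l ∈ S, L l := by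
    rw [hB, sum_principalMinor_conj _ Q hQ (by omega)]
    simp only [principalMinor_diagonal]
  rw [hD]
  constructor
  · refine Finset.sum_pos' (fun S _ => Finset.prod_nonneg fun l _ => hL l)
      ⟨({l | (l : ℕ) < k'} : Finset (Fin m)), ?_, ?_⟩
    · rw [Finset.mem_powersetCard_univ, Fin.card_filter_val_lt]
      omega
    · refine Finset.prod_pos fun l hl => ?_
      simp only [Finset.mem_filter, Finset.mem_univ, true_and] at hl
      exact (hpos (l + 1) (by omega) (by omega)).2 (by omega)
  · rintro w ⟨v, rfl⟩
    set u : Fin m → ℝ := Qᵀ *ᵥ v with hu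
    have hz : A *ᵥ (Aᵀ *ᵥ v) = Q *ᵥ (diagonal L *ᵥ u) := by
      rw [mulVec_mulVec, hB, ← mulVec_mulVec, ← mulVec_mulVec]
    have hnorm : (Aᵀ *ᵥ v) ⬝ᵥ (Aᵀ *ᵥ v) = ∑ i, L i * u i ^ 2 := by
      rw [mulVec_transpose, ← dotProduct_mulVec, ← mulVec_transpose, hz, dotProduct_mulVec,
        ← mulVec_transpose]
      refine Finset.sum_congr rfl fun i _ => ?_
      rw [mulVec_diagonal, ← hu]
      ring
    rw [dotProduct_sum_rowSub_mulVec A L Q hQ hB (by omega) _ _ hz, hnorm]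
    have hquad : ∑ S ∈ Finset.powersetCard k' (Finset.univ : Finset (Fin m)),
        ∑ i ∈ S, (diagonal L *ᵥ u) i ^ 2 * ∏ j ∈ S.erase i, L j =
        ∑ i, L i * u i ^ 2 *
          ∑ S ∈ Finset.powersetCard k' (Finset.univ : Finset (Fin m)) with i ∈ S,
            ∏ l ∈ S, L l := by
      simp_rw [Finset.mul_sum, Finset.sum_filter]
      rw [Finset.sum_comm]
      refine Finset.sum_congr rfl fun S _ => ?_
      rw [← Finset.sum_filter, Finset.filter_mem_eq_inter, Finset.univ_inter]
      refine Finset.sum_congr rfl fun i hi => ?_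
      rw [mulVec_diagonal, ← Finset.mul_prod_erase S L hi]
      ring
    rw [hquad, Finset.mul_sum]
    refine Finset.sum_le_sum fun i _ => ?_
    rcases lt_or_ge (i : ℕ) r with hir | hir
    · rw [mul_comm]
      exact mul_le_mul_of_nonneg_left
        (esymm_mul_le_sum_mem lam hrm hmono hnonneg hpos hkk' hk'r i hir)
        (mul_nonneg (hL i) (sq_nonneg _))
    · have hLi : L i = 0 := by
        refine le_antisymm (not_lt.1 fun h => ?_) (hL i)
        have := (hpos (i + 1) (by omega) (by omega)).1 h
        omega
      simp [hLi]
end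

section
/- Let m = 2^p for a nonnegative integer p, let H be the m×m Sylvester–Hadamard matrix, let A be a real m×n matrix, let 1 ≤ k ≤ m, and let δ ∈ (0,1). Let d be a Rademacher vector uniform on {−1,1}^m, and set L(d) := (1/m)·(H·diag(d)·A)·(H·diag(d)·A)ᵀ. Then with probability at least 1 − δ over d, for every index j ∈ {1,…,m}: Σ_{S ⊆ {1,…,m}, |S| = k, j ∈ S} det(L(d)_{S,S}) ≤ (√(k/m) + √(8·ln(m/δ)/m))² · Σ_{S ⊆ {1,…,m}, |S| = k} det(L(d)_{S,S}). (Equivalently, every marginal probability Pr{j ∈ S} of the k-DPP with kernel L(d), defined by Pr{S} ∝ det(L(d)_{S,S}) over subsets of size k, is at most (√(k/m)+√(8 log(m/δ)/m))².) -/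
open Matrix

/-- The Sylvester–Hadamard matrix of dimension `2^p × 2^p`, defined recursively by
`H⁽¹⁾ = [1]` and `H⁽²ⁿ⁾ = [[Hⁿ, Hⁿ], [Hⁿ, −Hⁿ]]`. -/
def sylvesterHadamard : (p : ℕ) → Matrix (Fin (2 ^ p)) (Fin (2 ^ p)) ℝ
  | 0 => 1
  | (p + 1) =>
      (Matrix.fromBlocks (sylvesterHadamard p) (sylvesterHadamard p)
          (sylvesterHadamard p) (-sylvesterHadamard p)).submatrix
        (fun i => finSumFinEquiv.symm (Fin.cast (by rw [pow_succ, mul_two]) i))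
        (fun j => finSumFinEquiv.symm (Fin.cast (by rw [pow_succ, mul_two]) j))

/-- The randomized-Hadamard-transform `k`-DPP kernel
`L(d) = (1/m)·(H·diag(d)·A)·(H·diag(d)·A)ᵀ`, `m = 2^p`, for the sign pattern
`s : Fin m → Bool` (encoding the Rademacher vector `d = ±1`). -/
noncomputable def rhtKernel (p n : ℕ) (A : Matrix (Fin (2 ^ p)) (Fin n) ℝ)
    (s : Fin (2 ^ p) → Bool) : Matrix (Fin (2 ^ p)) (Fin (2 ^ p)) ℝ :=
  ((2 ^ p : ℝ))⁻¹ •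
    ((sylvesterHadamard p * Matrix.diagonal (fun i => if s i then (1 : ℝ) else -1) * A) *
      (sylvesterHadamard p * Matrix.diagonal (fun i => if s i then (1 : ℝ) else -1) * A)ᵀ)

open MeasureTheory ProbabilityTheory in
lemma integrable_exp_mul_sq_gaussianReal {c : ℝ} (hc : c < 1 / 2) :
    Integrable (fun x => Real.exp (c * x ^ 2)) (gaussianReal 0 1) := by
  rw [gaussianReal_of_var_ne_zero _ one_ne_zero, integrable_withDensity_iff
    (measurable_gaussianPDF 0 1) (ae_of_all _ fun _ => gaussianPDF_lt_top)]
  have h := (integrable_exp_neg_mul_sq (b := 1 / 2 - c) (by linarith)).mul_const (√(2 * Real.pi))⁻¹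
  refine h.congr (ae_of_all _ fun x => ?_)
  simp only [toReal_gaussianPDF, gaussianPDFReal, NNReal.coe_one, sub_zero, mul_one]
  rw [mul_left_comm, ← Real.exp_add, mul_comm]
  congr 2
  ring

open MeasureTheory ProbabilityTheory in
lemma integral_exp_mul_sq_gaussianReal (c : ℝ) :
    ∫ x, Real.exp (c * x ^ 2) ∂(gaussianReal 0 1) = √(1 / (1 - 2 * c)) := by
  rw [integral_gaussianReal_eq_integral_smul one_ne_zero]
  have h : ∀ x : ℝ, gaussianPDFReal 0 1 x • Real.exp (c * x ^ 2) =
      (√(2 * Real.pi))⁻¹ * Real.exp (-(1 / 2 - c) * x ^ 2) := fun x => by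
    simp only [gaussianPDFReal, NNReal.coe_one, sub_zero, mul_one, smul_eq_mul]
    rw [mul_assoc, ← Real.exp_add]
    congr 2
    ring
  simp_rw [h]
  rw [integral_const_mul, integral_gaussian, ← Real.sqrt_inv, ← Real.sqrt_mul (by positivity)]
  congr 1
  have := Real.pi_ne_zero
  rw [show 1 / 2 - c = (1 - 2 * c) / 2 by ring]
  field_simp

lemma sqrt_one_div_one_sub_le {y : ℝ} (h0 : 0 ≤ y) (h1 : y ≤ 1 / 2) :
    √(1 / (1 - y)) ≤ Real.exp ((y + y ^ 2) / 2) := by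
  rw [Real.sqrt_le_left (Real.exp_pos _).le, ← Real.exp_nat_mul, div_le_iff₀ (by linarith)]
  have h := Real.quadratic_le_exp_of_nonneg (x := y + y ^ 2) (by positivity)
  have e : ((2 : ℕ) : ℝ) * ((y + y ^ 2) / 2) = y + y ^ 2 := by push_cast; ring
  rw [e]
  refine le_trans ?_ (mul_le_mul_of_nonneg_right h (by linarith))
  have : 0 ≤ y ^ 2 * (1 - y - y ^ 2 - y ^ 3) := by
    apply mul_nonneg (by positivity)
    have h2 : y ^ 2 ≤ 1 / 4 := by nlinarith
    have h3 : y ^ 3 ≤ 1 / 4 := by nlinarith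
    linarith
  nlinarith

/-- The real sign `±1` encoded by a Boolean. -/
def boolSign (b : Bool) : ℝ := if b then 1 else -1

lemma sum_exp_boolSign_le {ι : Type*} [Fintype ι] [DecidableEq ι] (z : ι → ℝ) :
    ∑ s : ι → Bool, Real.exp (∑ l, boolSign (s l) * z l) ≤
      2 ^ Fintype.card ι * Real.exp ((∑ l, z l ^ 2) / 2) := by
  simp_rw [Real.exp_sum]
  rw [← Fintype.prod_sum (fun l b => Real.exp (boolSign b * z l)), Finset.sum_div, Real.exp_sum,
    ← Finset.card_univ, ← Finset.prod_const, ← Finset.prod_mul_distrib]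
  refine Finset.prod_le_prod (fun _ _ => by positivity) fun l _ => ?_
  have h := Real.cosh_le_exp_half_sq (z l)
  rw [Real.cosh_eq] at h
  simp only [Fintype.sum_bool, boolSign, if_true, Bool.false_eq_true, if_false, one_mul, neg_mul]
  linarith

lemma sum_sq_sum_of_orthonormal {ι κ : Type*} [Fintype ι] [Fintype κ] [DecidableEq κ]
    {u : κ → ι → ℝ} (hu : ∀ i j, ∑ l, u i l * u j l = if i = j then 1 else 0) (g : κ → ℝ) :
    ∑ l, (∑ i, g i * u i l) ^ 2 = ∑ i, g i ^ 2 := by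
  simp_rw [sq, Finset.sum_mul_sum]
  rw [Finset.sum_comm]
  refine Finset.sum_congr rfl fun i _ => ?_
  rw [Finset.sum_comm]
  have : ∀ j, ∑ l, g i * u i l * (g j * u j l) = g i * g j * if i = j then 1 else 0 := fun j => by
    rw [← hu, Finset.mul_sum]
    exact Finset.sum_congr rfl fun l _ => by ring
  simp [this]

open MeasureTheory ProbabilityTheory in
lemma sum_exp_quadratic_boolSign_le {ι κ : Type*} [Fintype ι] [DecidableEq ι] [Fintype κ]
    [DecidableEq κ] {u : κ → ι → ℝ} (hu : ∀ i j, ∑ l, u i l * u j l = if i = j then 1 else 0)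
    (c : κ → ℝ) (hc : ∀ i, c i ^ 2 < 1) :
    ∑ s : ι → Bool, Real.exp (∑ i, (c i * ∑ l, boolSign (s l) * u i l) ^ 2 / 2) ≤
      2 ^ Fintype.card ι * ∏ i, √(1 / (1 - c i ^ 2)) := by
  set γ : Measure (κ → ℝ) := Measure.pi fun _ => gaussianReal 0 1
  have hint : ∀ s : ι → Bool, Integrable
      (fun g : κ → ℝ => ∏ i, Real.exp ((c i * ∑ l, boolSign (s l) * u i l) * g i)) γ := fun s =>
    Integrable.fintype_prod fun i => integrable_exp_mul_gaussianReal _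
  have hlin : ∀ s : ι → Bool,
      Real.exp (∑ i, (c i * ∑ l, boolSign (s l) * u i l) ^ 2 / 2) =
      ∫ g, ∏ i, Real.exp ((c i * ∑ l, boolSign (s l) * u i l) * g i) ∂γ := fun s => by
    rw [integral_fintype_prod_eq_prod (𝕜 := ℝ)
      (fun i x => Real.exp ((c i * ∑ l, boolSign (s l) * u i l) * x)), Real.exp_sum]
    refine Finset.prod_congr rfl fun i _ => ?_
    have h := congrFun (mgf_id_gaussianReal (μ := 0) (v := 1))
      (c i * ∑ l, boolSign (s l) * u i l)
    simp only [mgf, id] at h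
    rw [h]
    simp
  have hprod : ∏ i, √(1 / (1 - c i ^ 2)) =
      ∫ g, ∏ i, Real.exp (c i ^ 2 / 2 * g i ^ 2) ∂γ := by
    rw [integral_fintype_prod_eq_prod (𝕜 := ℝ) (fun i x => Real.exp (c i ^ 2 / 2 * x ^ 2))]
    refine Finset.prod_congr rfl fun i _ => ?_
    rw [integral_exp_mul_sq_gaussianReal, mul_div_cancel₀ _ two_ne_zero]
  simp_rw [hlin]
  rw [hprod, ← integral_finsetSum _ fun s _ => hint s, ← integral_const_mul]
  refine integral_mono (integrable_finsetSum _ fun s _ => hint s) (Integrable.const_mul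
    (Integrable.fintype_prod (f := fun i x => Real.exp (c i ^ 2 / 2 * x ^ 2)) fun i =>
      integrable_exp_mul_sq_gaussianReal (by linarith [hc i])) _) fun g => ?_
  simp only [← Real.exp_sum]
  have hl : ∀ s : ι → Bool, ∑ i, (c i * ∑ l, boolSign (s l) * u i l) * g i =
      ∑ l, boolSign (s l) * ∑ i, (c i * g i) * u i l := fun s => by
    simp_rw [Finset.mul_sum, Finset.sum_mul]
    rw [Finset.sum_comm]
    exact Finset.sum_congr rfl fun l _ => Finset.sum_congr rfl fun i _ => by ring
  have hr : ∑ i, c i ^ 2 / 2 * g i ^ 2 = (∑ l, (∑ i, (c i * g i) * u i l) ^ 2) / 2 := by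
    rw [sum_sq_sum_of_orthonormal hu, Finset.sum_div]
    exact Finset.sum_congr rfl fun i _ => by ring
  simp_rw [hl, hr]
  exact sum_exp_boolSign_le _

lemma exists_chernoff_parameter {κ t : ℝ} (hκ : 0 < κ) (ht : 0 < t) :
    ∃ r : ℝ, 0 ≤ r ∧ r ≤ 1 / 4 ∧
      r * κ + 2 * r ^ 2 * κ - r * (√κ + √(8 * t)) ^ 2 ≤ -t := by
  obtain ⟨a, ha, rfl⟩ : ∃ a, 0 < a ∧ κ = a ^ 2 :=
    ⟨√κ, Real.sqrt_pos.2 hκ, (Real.sq_sqrt hκ.le).symm⟩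
  obtain ⟨b, hb, rfl⟩ : ∃ b, 0 < b ∧ t = b ^ 2 :=
    ⟨√t, Real.sqrt_pos.2 ht, (Real.sq_sqrt ht.le).symm⟩
  have h8 : 2 * b ≤ √(8 * b ^ 2) := Real.le_sqrt_of_sq_le (by nlinarith)
  have h8' : √(8 * b ^ 2) ^ 2 = 8 * b ^ 2 := Real.sq_sqrt (by positivity)
  rw [Real.sqrt_sq ha.le]
  set y := √(8 * b ^ 2)
  rcases le_total (2 * b) a with h | h
  · refine ⟨b / (2 * a), by positivity, by rw [div_le_iff₀ (by positivity)]; linarith, ?_⟩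
    set r := b / (2 * a) with hr
    have hra : r * a = b / 2 := by rw [hr]; field_simp
    have e : r * a ^ 2 + 2 * r ^ 2 * a ^ 2 - r * (a + y) ^ 2 =
      2 * (r * a) ^ 2 - 2 * (r * a) * y - r * y ^ 2 := by ring
    rw [e, hra]
    have : 0 ≤ r * y ^ 2 := by positivity
    nlinarith
  · refine ⟨1 / 4, by norm_num, le_rfl, ?_⟩
    have : 0 ≤ a * y := by positivity
    nlinarith

lemma card_quadratic_boolSign_gt_le {ι κ : Type*} [Fintype ι] [DecidableEq ι] [Fintype κ]
    [DecidableEq κ] {u : κ → ι → ℝ} (hu : ∀ i j, ∑ l, u i l * u j l = if i = j then 1 else 0)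
    {w : κ → ℝ} (hw0 : ∀ i, 0 ≤ w i) (hw1 : ∀ i, w i ≤ 1) (hw : 0 < ∑ i, w i) {t : ℝ}
    (ht : 0 < t) (B : Finset (ι → Bool))
    (hB : ∀ s ∈ B, (√(∑ i, w i) + √(8 * t)) ^ 2 ≤
      ∑ i, (∑ l, boolSign (s l) * u i l) ^ 2 * w i) :
    (B.card : ℝ) ≤ 2 ^ Fintype.card ι * Real.exp (-t) := by
  obtain ⟨r, hr0, hr1, hr⟩ := exists_chernoff_parameter hw ht
  set θ := (√(∑ i, w i) + √(8 * t)) ^ 2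
  have hsq : ∀ i, √(2 * r * w i) ^ 2 = 2 * r * w i := fun i =>
    Real.sq_sqrt (mul_nonneg (by positivity) (hw0 i))
  have hy0 : ∀ i, 0 ≤ 2 * r * w i := fun i => mul_nonneg (by positivity) (hw0 i)
  have hy1 : ∀ i, 2 * r * w i ≤ 1 / 2 := fun i => by nlinarith [hw0 i, hw1 i]
  have hmgf := sum_exp_quadratic_boolSign_le hu (fun i => √(2 * r * w i))
    (fun i => by rw [hsq]; linarith [hy1 i])
  simp only [hsq, mul_pow] at hmgf
  have hprod : ∏ i, √(1 / (1 - 2 * r * w i)) ≤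
      Real.exp (r * ∑ i, w i + 2 * r ^ 2 * ∑ i, w i) := by
    refine (Finset.prod_le_prod (fun _ _ => by positivity) fun i _ =>
      sqrt_one_div_one_sub_le (hy0 i) (hy1 i)).trans ?_
    rw [← Real.exp_sum, Real.exp_le_exp, Finset.mul_sum, Finset.mul_sum, ← Finset.sum_add_distrib]
    refine Finset.sum_le_sum fun i _ => ?_
    have : w i ^ 2 ≤ w i := by nlinarith [hw0 i, hw1 i]
    nlinarith [mul_le_mul_of_nonneg_left this (sq_nonneg r)]
  have hlow : (B.card : ℝ) * Real.exp (r * θ) ≤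
      ∑ s : ι → Bool, Real.exp
        (∑ i, 2 * r * w i * (∑ l, boolSign (s l) * u i l) ^ 2 / 2) := by
    rw [← nsmul_eq_mul]
    refine (Finset.card_nsmul_le_sum B _ _ fun s hs => ?_).trans
      (Finset.sum_le_sum_of_subset_of_nonneg (Finset.subset_univ B)
        fun _ _ _ => (Real.exp_pos _).le)
    rw [Real.exp_le_exp]
    refine (mul_le_mul_of_nonneg_left (hB s hs) hr0).trans_eq ?_
    rw [Finset.mul_sum]
    exact Finset.sum_congr rfl fun i _ => by ring
  have h := hlow.trans (hmgf.trans (mul_le_mul_of_nonneg_left hprod (by positivity)))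
  rw [← le_div_iff₀ (Real.exp_pos _), mul_div_assoc, ← Real.exp_sub] at h
  exact h.trans (mul_le_mul_of_nonneg_left (Real.exp_le_exp.2 hr) (by positivity))

lemma sum_principalMinor_mul_comm {m : ℕ} (M N : Matrix (Fin m) (Fin m) ℝ) (k : ℕ) :
    ∑ S ∈ Finset.powersetCard k Finset.univ, principalMinor (M * N) S =
      ∑ S ∈ Finset.powersetCard k Finset.univ, principalMinor (N * M) S := by
  have h := fun M : Matrix (Fin m) (Fin m) ℝ =>
    Matrix.coeff_det_one_add_X_smul_eq_sum_minors M k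
  simp only [principalMinor]
  rw [← h, ← h, Matrix.map_mul, Matrix.map_mul, ← smul_mul_assoc, Matrix.det_one_add_mul_comm,
    mul_smul_comm]

lemma principalMinor_diagonal_mul_of_mem {m : ℕ} (M : Matrix (Fin m) (Fin m) ℝ)
    (j : Fin m) {S : Finset (Fin m)} (hj : j ∈ S) :
    principalMinor (Matrix.diagonal (fun i => if i = j then 0 else 1) * M) S = 0 := by
  refine Matrix.det_eq_zero_of_row_eq_zero ⟨j, hj⟩ fun i => ?_
  simp [Matrix.diagonal_mul]

lemma principalMinor_diagonal_mul_of_notMem {m : ℕ} (M : Matrix (Fin m) (Fin m) ℝ)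
    (j : Fin m) {S : Finset (Fin m)} (hj : j ∉ S) :
    principalMinor (Matrix.diagonal (fun i => if i = j then 0 else 1) * M) S =
      principalMinor M S := by
  unfold principalMinor
  congr 1
  ext a b
  have : (a : Fin m) ≠ j := fun h => hj (h ▸ a.2)
  simp [Matrix.diagonal_mul, this]

lemma sum_principalMinor_filter_mem {m : ℕ} (M : Matrix (Fin m) (Fin m) ℝ) (k : ℕ) (j : Fin m) :
    ∑ S ∈ (Finset.powersetCard k Finset.univ).filter (fun S => j ∈ S), principalMinor M S =
      ∑ S ∈ Finset.powersetCard k Finset.univ, principalMinor M S -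
      ∑ S ∈ Finset.powersetCard k Finset.univ,
        principalMinor (Matrix.diagonal (fun i => if i = j then 0 else 1) * M) S := by
  rw [← Finset.sum_sub_distrib, Finset.sum_filter]
  refine Finset.sum_congr rfl fun S _ => ?_
  split_ifs with h
  · rw [principalMinor_diagonal_mul_of_mem M j h, sub_zero]
  · rw [principalMinor_diagonal_mul_of_notMem M j h, sub_self]

lemma principalMinor_one_sub_vecMulVec_mul_diagonal {m : ℕ} (v w l : Fin m → ℝ)
    (S : Finset (Fin m)) :
    principalMinor ((1 - Matrix.vecMulVec v w) * Matrix.diagonal l) S =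
      (1 - ∑ i ∈ S, v i * w i) * ∏ i ∈ S, l i := by
  have h : ((1 - Matrix.vecMulVec v w) * Matrix.diagonal l).submatrix
      (fun i : {x // x ∈ S} => (i : Fin m)) (fun i : {x // x ∈ S} => (i : Fin m)) =
      (1 + Matrix.replicateCol Unit (fun i : S => -v i) *
        Matrix.replicateRow Unit (fun i : S => w i)) * Matrix.diagonal (fun i : S => l i) := by
    ext a b
    rw [← Matrix.vecMulVec_eq]
    simp only [Matrix.submatrix_apply, Matrix.mul_diagonal, Matrix.sub_apply, Matrix.add_apply,
      Matrix.vecMulVec_apply, Matrix.one_apply, Subtype.ext_iff]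
    ring
  rw [principalMinor, h, Matrix.det_mul, Matrix.det_diagonal,
    Matrix.det_one_add_replicateCol_mul_replicateRow, Finset.prod_coe_sort S l]
  congr 1
  rw [← Finset.sum_coe_sort S (fun i => v i * w i)]
  simp only [dotProduct, mul_neg, Finset.sum_neg_distrib, sub_eq_add_neg]
  congr 2
  exact Finset.sum_congr rfl fun i _ => mul_comm _ _

lemma sum_principalMinor_conj_diagonal {m : ℕ} {V : Matrix (Fin m) (Fin m) ℝ}
    (hV : Vᵀ * V = 1) (l : Fin m → ℝ) (k : ℕ) :
    ∑ S ∈ Finset.powersetCard k Finset.univ, principalMinor (V * Matrix.diagonal l * Vᵀ) S =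
      ∑ S ∈ Finset.powersetCard k Finset.univ, ∏ i ∈ S, l i := by
  rw [sum_principalMinor_mul_comm, ← mul_assoc, hV]
  refine Finset.sum_congr rfl fun S _ => ?_
  simpa using principalMinor_one_sub_vecMulVec_mul_diagonal 0 0 l S

lemma sum_principalMinor_conj_diagonal_filter_mem {m : ℕ} {V : Matrix (Fin m) (Fin m) ℝ}
    (hV : Vᵀ * V = 1) (l : Fin m → ℝ) (k : ℕ) (j : Fin m) :
    ∑ S ∈ (Finset.powersetCard k Finset.univ).filter (fun S => j ∈ S),
        principalMinor (V * Matrix.diagonal l * Vᵀ) S =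
      ∑ i, V j i ^ 2 * ∑ S ∈ (Finset.powersetCard k Finset.univ).filter (fun S => i ∈ S),
        ∏ i ∈ S, l i := by
  have hrank : Vᵀ * Matrix.diagonal (fun i => if i = j then 0 else 1) * V =
      1 - Matrix.vecMulVec (V j) (V j) := by
    have : Matrix.diagonal (fun i => if i = j then (0 : ℝ) else 1) =
        1 - Matrix.vecMulVec (Pi.single j 1) (Pi.single j 1) := by
      ext a b
      by_cases hab : a = b
      · subst hab
        by_cases haj : a = j <;> simp [Matrix.vecMulVec_apply, haj]
      · by_cases haj : a = j
        · subst haj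
          simp [Matrix.vecMulVec_apply, hab, Ne.symm hab]
        · simp [Matrix.vecMulVec_apply, hab, haj]
    rw [this, mul_sub, sub_mul, mul_one, hV, Matrix.mul_vecMulVec, Matrix.vecMulVec_mul]
    congr 2 <;> ext i <;> simp
  rw [sum_principalMinor_filter_mem, sum_principalMinor_conj_diagonal hV,
    show Matrix.diagonal (fun i => if i = j then (0 : ℝ) else 1) * (V * Matrix.diagonal l * Vᵀ) =
      (Matrix.diagonal (fun i => if i = j then (0 : ℝ) else 1) * (V * Matrix.diagonal l)) * Vᵀ from
      (mul_assoc _ _ _).symm,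
    sum_principalMinor_mul_comm, ← mul_assoc, ← mul_assoc, hrank, ← Finset.sum_sub_distrib]
  simp_rw [principalMinor_one_sub_vecMulVec_mul_diagonal, Finset.sum_filter, Finset.mul_sum]
  rw [Finset.sum_comm]
  refine Finset.sum_congr rfl fun S _ => ?_
  rw [sub_mul, one_mul, sub_sub_cancel, Finset.sum_mul]
  simp only [mul_ite, mul_zero, Finset.sum_ite_mem, Finset.univ_inter, sq]

lemma sylvesterHadamard_apply_sq (p : ℕ) (i j : Fin (2 ^ p)) :
    sylvesterHadamard p i j ^ 2 = 1 := by
  induction p with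
  | zero =>
    have : i = j := Fin.ext (by have := i.2; have := j.2; simp only [pow_zero] at *; lia)
    subst this
    change (1 : Matrix (Fin (2 ^ 0)) (Fin (2 ^ 0)) ℝ) i i ^ 2 = 1
    rw [Matrix.one_apply_eq, one_pow]
  | succ p ih =>
    simp only [sylvesterHadamard, Matrix.submatrix_apply]
    generalize finSumFinEquiv.symm (Fin.cast _ i) = a
    generalize finSumFinEquiv.symm (Fin.cast _ j) = b
    rcases a with a | a <;> rcases b with b | b <;> simp [ih]

lemma sylvesterHadamard_transpose_mul_self (p : ℕ) :
    (sylvesterHadamard p)ᵀ * sylvesterHadamard p = (2 ^ p : ℝ) • 1 := by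
  induction p with
  | zero => simp [sylvesterHadamard]
  | succ p ih =>
    have hp : 2 ^ (p + 1) = 2 ^ p + 2 ^ p := by rw [pow_succ, mul_two]
    let e : Fin (2 ^ (p + 1)) ≃ Fin (2 ^ p) ⊕ Fin (2 ^ p) :=
      (finCongr hp).trans finSumFinEquiv.symm
    have h : sylvesterHadamard (p + 1) = (Matrix.fromBlocks (sylvesterHadamard p)
        (sylvesterHadamard p) (sylvesterHadamard p) (-sylvesterHadamard p)).submatrix e e := rfl
    rw [h, Matrix.transpose_submatrix, Matrix.submatrix_mul_equiv, Matrix.fromBlocks_transpose,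
      Matrix.fromBlocks_multiply]
    simp only [Matrix.transpose_neg, mul_neg, neg_mul, neg_neg, ih, add_neg_cancel]
    have hd : Matrix.fromBlocks ((2 ^ p : ℝ) • (1 : Matrix (Fin (2 ^ p)) (Fin (2 ^ p)) ℝ) +
        (2 ^ p : ℝ) • 1) 0 0 ((2 ^ p : ℝ) • 1 + (2 ^ p : ℝ) • 1) =
        (2 ^ (p + 1) : ℝ) •
          (1 : Matrix (Fin (2 ^ p) ⊕ Fin (2 ^ p)) (Fin (2 ^ p) ⊕ Fin (2 ^ p)) ℝ) := by
      rw [← Matrix.fromBlocks_one, Matrix.fromBlocks_smul, ← add_smul, ← two_mul, ← pow_succ']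
      simp only [smul_zero]
    rw [hd]
    ext i j
    simp [Matrix.one_apply]

lemma exists_orthogonal_diagonalization_mul_transpose {m n : ℕ} (A : Matrix (Fin m) (Fin n) ℝ) :
    ∃ (U : Matrix (Fin m) (Fin m) ℝ) (l : Fin m → ℝ), Uᵀ * U = 1 ∧ (∀ i, 0 ≤ l i) ∧
      A * Aᵀ = U * Matrix.diagonal l * Uᵀ := by
  have h : (A * Aᵀ).PosSemidef := by
    simpa [Matrix.conjTranspose_eq_transpose_of_trivial] using
      Matrix.posSemidef_self_mul_conjTranspose A
  refine ⟨h.1.eigenvectorUnitary, h.1.eigenvalues, ?_, h.eigenvalues_nonneg, ?_⟩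
  · simpa [Matrix.star_eq_conjTranspose, Matrix.conjTranspose_eq_transpose_of_trivial] using
      Unitary.coe_star_mul_self h.1.eigenvectorUnitary
  · simpa [Unitary.conjStarAlgAut_apply, Matrix.star_eq_conjTranspose, Function.comp_def,
      Matrix.conjTranspose_eq_transpose_of_trivial] using h.1.spectral_theorem

/-- The orthogonal matrix `m^{-1/2} · H · diag(d) · U`, with `m = 2^p`. -/
noncomputable def rhtFrame (p : ℕ) (U : Matrix (Fin (2 ^ p)) (Fin (2 ^ p)) ℝ)
    (s : Fin (2 ^ p) → Bool) : Matrix (Fin (2 ^ p)) (Fin (2 ^ p)) ℝ :=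
  (√(2 ^ p))⁻¹ • (sylvesterHadamard p * Matrix.diagonal (fun i => boolSign (s i)) * U)

lemma rhtFrame_transpose_mul_self (p : ℕ) {U : Matrix (Fin (2 ^ p)) (Fin (2 ^ p)) ℝ}
    (hU : Uᵀ * U = 1) (s : Fin (2 ^ p) → Bool) :
    (rhtFrame p U s)ᵀ * rhtFrame p U s = 1 := by
  have hd : Matrix.diagonal (fun i => boolSign (s i)) * Matrix.diagonal (fun i => boolSign (s i)) =
      1 := by
    rw [Matrix.diagonal_mul_diagonal, ← Matrix.diagonal_one]
    congr 1
    ext i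
    cases s i <;> simp [boolSign]
  have hm : (√(2 ^ p : ℝ))⁻¹ * (√(2 ^ p : ℝ))⁻¹ = (2 ^ p : ℝ)⁻¹ := by
    rw [← mul_inv, Real.mul_self_sqrt (by positivity)]
  rw [rhtFrame, Matrix.transpose_smul, smul_mul_smul_comm, hm, Matrix.transpose_mul,
    Matrix.transpose_mul, Matrix.diagonal_transpose]
  set D := Matrix.diagonal (fun i => boolSign (s i))
  rw [show Uᵀ * (D * (sylvesterHadamard p)ᵀ) * (sylvesterHadamard p * D * U) =
    Uᵀ * (D * ((sylvesterHadamard p)ᵀ * sylvesterHadamard p) * D) * U by simp only [mul_assoc],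
    sylvesterHadamard_transpose_mul_self]
  simp [hd, hU, smul_smul]

lemma rhtKernel_eq_rhtFrame {p n : ℕ} {A : Matrix (Fin (2 ^ p)) (Fin n) ℝ}
    {U : Matrix (Fin (2 ^ p)) (Fin (2 ^ p)) ℝ} {l : Fin (2 ^ p) → ℝ}
    (hA : A * Aᵀ = U * Matrix.diagonal l * Uᵀ) (s : Fin (2 ^ p) → Bool) :
    rhtKernel p n A s = rhtFrame p U s * Matrix.diagonal l * (rhtFrame p U s)ᵀ := by
  have hm : (√(2 ^ p : ℝ))⁻¹ * (√(2 ^ p : ℝ))⁻¹ = (2 ^ p : ℝ)⁻¹ := by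
    rw [← mul_inv, Real.mul_self_sqrt (by positivity)]
  rw [rhtFrame, Matrix.transpose_smul, smul_mul_assoc, smul_mul_smul_comm, hm]
  unfold rhtKernel boolSign
  set G := sylvesterHadamard p * Matrix.diagonal (fun i => if s i then (1 : ℝ) else -1)
  rw [Matrix.transpose_mul G A, Matrix.transpose_mul G U,
    show G * A * (Aᵀ * Gᵀ) = G * (A * Aᵀ) * Gᵀ by simp only [Matrix.mul_assoc], hA]
  simp only [Matrix.mul_assoc]

lemma rhtFrame_apply_sq (p : ℕ) (U : Matrix (Fin (2 ^ p)) (Fin (2 ^ p)) ℝ)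
    (s : Fin (2 ^ p) → Bool) (j i : Fin (2 ^ p)) :
    rhtFrame p U s j i ^ 2 =
      (∑ a, boolSign (s a) * (sylvesterHadamard p j a * U a i)) ^ 2 / 2 ^ p := by
  rw [rhtFrame, Matrix.smul_apply, smul_eq_mul, mul_pow, inv_pow, Real.sq_sqrt (by positivity),
    Matrix.mul_apply, div_eq_inv_mul]
  congr 3
  ext a
  rw [Matrix.mul_diagonal]
  ring

lemma sum_sum_filter_mem_powersetCard {m : ℕ} (f : Finset (Fin m) → ℝ) (k : ℕ) :
    ∑ i, ∑ S ∈ (Finset.powersetCard k Finset.univ).filter (fun S => i ∈ S), f S =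
      k * ∑ S ∈ Finset.powersetCard k Finset.univ, f S := by
  simp_rw [Finset.sum_filter]
  rw [Finset.sum_comm, Finset.mul_sum]
  refine Finset.sum_congr rfl fun S hS => ?_
  rw [Finset.sum_ite_mem, Finset.univ_inter, Finset.sum_const, (Finset.mem_powersetCard.1 hS).2,
    nsmul_eq_mul]

lemma card_rhtKernel_marginal_gt_le (p n : ℕ) (A : Matrix (Fin (2 ^ p)) (Fin n) ℝ) {k : ℕ}
    (hk : 1 ≤ k) {t : ℝ} (ht : 0 < t) (j : Fin (2 ^ p)) (B : Finset (Fin (2 ^ p) → Bool))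
    (hB : ∀ s ∈ B, (√((k : ℝ) / 2 ^ p) + √(8 * t / 2 ^ p)) ^ 2 *
        ∑ S ∈ Finset.powersetCard k Finset.univ, principalMinor (rhtKernel p n A s) S <
      ∑ S ∈ (Finset.powersetCard k Finset.univ).filter (fun S => j ∈ S),
        principalMinor (rhtKernel p n A s) S) :
    (B.card : ℝ) ≤ 2 ^ 2 ^ p * Real.exp (-t) := by
  obtain ⟨U, l, hU, hl, hA⟩ := exists_orthogonal_diagonalization_mul_transpose A
  simp_rw [rhtKernel_eq_rhtFrame hA,
    sum_principalMinor_conj_diagonal (rhtFrame_transpose_mul_self p hU _),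
    sum_principalMinor_conj_diagonal_filter_mem (rhtFrame_transpose_mul_self p hU _),
    rhtFrame_apply_sq] at hB
  have ha : ∀ S : Finset (Fin (2 ^ p)), 0 ≤ ∏ i ∈ S, l i :=
    fun S => Finset.prod_nonneg fun i _ => hl i
  set E := ∑ S ∈ Finset.powersetCard k Finset.univ, ∏ i ∈ S, l i
  set b : Fin (2 ^ p) → ℝ := fun i =>
    ∑ S ∈ (Finset.powersetCard k Finset.univ).filter (fun S => i ∈ S), ∏ i ∈ S, l i
  have hb0 : ∀ i, 0 ≤ b i := fun i => Finset.sum_nonneg fun S _ => ha S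
  have hbE : ∀ i, b i ≤ E := fun i =>
    Finset.sum_le_sum_of_subset_of_nonneg (Finset.filter_subset _ _) fun S _ _ => ha S
  have hbk : ∑ i, b i = k * E := sum_sum_filter_mem_powersetCard _ k
  have hE0 : 0 ≤ E := Finset.sum_nonneg fun S _ => ha S
  rcases hE0.eq_or_lt with hE | hE
  · have hb' : ∀ i, b i = 0 := fun i => le_antisymm (hE ▸ hbE i) (hb0 i)
    have : B = ∅ := Finset.eq_empty_of_forall_notMem fun s hs => by
      have h := hB s hs
      change _ < ∑ i, _ * b i at h
      simp [hb', ← hE] at h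
    rw [this]
    simp only [Finset.card_empty, Nat.cast_zero]
    positivity
  have hwk : ∑ i, b i / E = k := by
    rw [← Finset.sum_div, hbk, mul_div_cancel_right₀ _ hE.ne']
  have hk0 : (0 : ℝ) < k := by exact_mod_cast hk
  have h := card_quadratic_boolSign_gt_le (u := fun i a => sylvesterHadamard p j a * U a i)
    (w := fun i => b i / E) (t := t) (fun i i' => ?_) (fun i => div_nonneg (hb0 i) hE.le)
    (fun i => (div_le_one hE).2 (hbE i)) (by rw [hwk]; exact hk0) ht B (fun s hs => ?_)
  · simpa using h
  · have h := congrFun (congrFun hU i) i'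
    rw [Matrix.mul_apply, Matrix.one_apply] at h
    rw [← h]
    refine Finset.sum_congr rfl fun a _ => ?_
    rw [Matrix.transpose_apply]
    linear_combination U a i * U a i' * sylvesterHadamard_apply_sq p j a
  · have h := (hB s hs).le
    change _ ≤ ∑ i, _ * b i at h
    have e : √((k : ℝ) / 2 ^ p) + √(8 * t / 2 ^ p) = (√k + √(8 * t)) / √(2 ^ p) := by
      rw [Real.sqrt_div hk0.le, Real.sqrt_div (by positivity), add_div]
    rw [e, div_pow, Real.sq_sqrt (by positivity), div_mul_eq_mul_div, div_le_iff₀ (by positivity),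
      ← le_div_iff₀ hE] at h
    rw [hwk]
    refine h.trans_eq ?_
    rw [Finset.sum_mul, Finset.sum_div]
    exact Finset.sum_congr rfl fun i _ => by field_simp

open Classical in
/-- approximately isotropic `k`-DPP marginals after the RHT: let
`m = 2^p`, `H` the `m × m` Sylvester–Hadamard matrix, `A` a real `m × n` matrix,
`1 ≤ k ≤ m`, `δ ∈ (0,1)`, and for a Rademacher sign vector `d ∈ {−1,1}^m` set
`L(d) := (1/m)(H·diag(d)·A)(H·diag(d)·A)ᵀ`. Then with probability at least `1 − δ`
over `d` (uniform on `{−1,1}^m`, expressed by counting sign patterns), for every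
index `j`:
`Σ_{|S| = k, j ∈ S} det(L(d)_{S,S}) ≤ (√(k/m) + √(8·ln(m/δ)/m))² · Σ_{|S| = k} det(L(d)_{S,S})`,
i.e. every marginal of the `k`-DPP with kernel `L(d)` is at most
`(√(k/m) + √(8 log(m/δ)/m))²`. -/
theorem stmt8 (p n : ℕ) (A : Matrix (Fin (2 ^ p)) (Fin n) ℝ) (k : ℕ)
    (hk1 : 1 ≤ k) (hkm : k ≤ 2 ^ p) (δ : ℝ) (hδ0 : 0 < δ) (hδ1 : δ < 1) :
    (1 - δ) * 2 ^ (2 ^ p) ≤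
      ((Finset.univ.filter (fun s : Fin (2 ^ p) → Bool =>
          ∀ j : Fin (2 ^ p),
            ∑ S ∈ (Finset.powersetCard k (Finset.univ : Finset (Fin (2 ^ p)))).filter
                (fun S => j ∈ S), principalMinor (rhtKernel p n A s) S
              ≤ (Real.sqrt ((k : ℝ) / 2 ^ p)
                    + Real.sqrt (8 * Real.log ((2 ^ p : ℝ) / δ) / 2 ^ p)) ^ 2 *
                  ∑ S ∈ Finset.powersetCard k (Finset.univ : Finset (Fin (2 ^ p))),
                    principalMinor (rhtKernel p n A s) S)).card : ℝ) := by
  have hm : (0 : ℝ) < 2 ^ p := by positivity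
  have ht : 0 < Real.log ((2 ^ p : ℝ) / δ) := Real.log_pos <| by
    rw [one_lt_div hδ0]
    exact hδ1.trans_le (one_le_pow₀ one_le_two)
  set P : (Fin (2 ^ p) → Bool) → Fin (2 ^ p) → Prop := fun s j =>
    ∑ S ∈ (Finset.powersetCard k (Finset.univ : Finset (Fin (2 ^ p)))).filter
        (fun S => j ∈ S), principalMinor (rhtKernel p n A s) S
      ≤ (Real.sqrt ((k : ℝ) / 2 ^ p)
            + Real.sqrt (8 * Real.log ((2 ^ p : ℝ) / δ) / 2 ^ p)) ^ 2 *
          ∑ S ∈ Finset.powersetCard k (Finset.univ : Finset (Fin (2 ^ p))),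
            principalMinor (rhtKernel p n A s) S with hP
  have hbad : ∀ j, ((Finset.univ.filter fun s => ¬ P s j).card : ℝ) ≤
      2 ^ 2 ^ p * (δ / 2 ^ p) := fun j => by
    have h := card_rhtKernel_marginal_gt_le p n A hk1 ht j (Finset.univ.filter fun s => ¬ P s j)
      fun s hs => by
        have h := (Finset.mem_filter.1 hs).2
        simp only [hP, not_le] at h
        convert h
    rwa [← Real.log_inv, inv_div, Real.exp_log (by positivity)] at h
  have hunion : ((Finset.univ.filter fun s => ¬ ∀ j, P s j).card : ℝ) ≤ δ * 2 ^ 2 ^ p := by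
    have hsub : (Finset.univ.filter fun s => ¬ ∀ j, P s j) ⊆
        Finset.univ.biUnion fun j => Finset.univ.filter fun s => ¬ P s j := fun s hs => by
      simpa using hs
    calc ((Finset.univ.filter fun s => ¬ ∀ j, P s j).card : ℝ)
        ≤ ∑ j, ((Finset.univ.filter fun s => ¬ P s j).card : ℝ) := by
          exact_mod_cast (Finset.card_le_card hsub).trans Finset.card_biUnion_le
      _ ≤ ∑ _j : Fin (2 ^ p), 2 ^ 2 ^ p * (δ / 2 ^ p) := Finset.sum_le_sum fun j _ => hbad j
      _ = δ * 2 ^ 2 ^ p := by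
          rw [Finset.sum_const, Finset.card_univ, Fintype.card_fin, nsmul_eq_mul]
          push_cast
          field_simp
  have htot : ((Finset.univ.filter fun s => ∀ j, P s j).card : ℝ) +
      ((Finset.univ.filter fun s => ¬ ∀ j, P s j).card : ℝ) = 2 ^ 2 ^ p := by
    have h := Finset.card_filter_add_card_filter_not
      (s := (Finset.univ : Finset (Fin (2 ^ p) → Bool))) fun s => ∀ j, P s j
    rw [Finset.card_univ, Fintype.card_fun, Fintype.card_bool, Fintype.card_fin] at h
    exact_mod_cast h
  linarith
end

section
/- Let A be a real m×n matrix of rank r, let B = A·Aᵀ, and let 1 ≤ k' ≤ r be an integer. Define the n×n matrix N := Σ_{S ⊆ {1,…,m}, |S| = k'} (A_{S,:})ᵀ · adj(B_{S,S}) · A_{S,:}. Then the kernel of N equals the kernel of A; that is, for every w ∈ ℝⁿ, N·w = 0 if and only if A·w = 0. (In particular, the nullspace of the expected k'-DPP projection matrix coincides with the nullspace of AᵀA.) -/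
open Matrix

/-- If the rows of `C` are dependent, then `adj(CCᵀ) C = 0`. -/
lemma adjugate_mul_self_eq_zero {ι κ : Type*} [Fintype ι] [DecidableEq ι] [Fintype κ]
    (C : Matrix ι κ ℝ) (hC : ¬ Function.Injective C.vecMul) :
    (C * Cᵀ).adjugate * C = 0 := by
  have hdet : (C * Cᵀ).det = 0 := by
    rw [← exists_vecMul_eq_zero_iff]
    rw [← Matrix.coe_vecMulLinear, ← LinearMap.ker_eq_bot, Submodule.eq_bot_iff] at hC
    push Not at hC
    obtain ⟨v, hv, hv0⟩ := hC
    refine ⟨v, hv0, ?_⟩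
    have hv' : v ᵥ* C = 0 := by simpa using hv
    rw [← vecMul_vecMul, hv', zero_vecMul]
  rw [← conjTranspose_eq_transpose_of_trivial] at hdet ⊢
  rw [← mul_self_mul_conjTranspose_eq_zero, adjugate_mul, hdet, zero_smul]

/-- If the rows of `C` are independent, then `adj(CCᵀ)` is positive definite. -/
lemma posDef_adjugate_mul_transpose {ι κ : Type*} [Fintype ι] [DecidableEq ι] [Fintype κ]
    (C : Matrix ι κ ℝ) (hC : Function.Injective C.vecMul) :
    (C * Cᵀ).adjugate.PosDef := by
  have hpd : (C * Cᵀ).PosDef := by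
    simpa using PosDef.mul_conjTranspose_self C hC
  have hadj : (C * Cᵀ).adjugate = (C * Cᵀ).det • (C * Cᵀ)⁻¹ := by
    rw [inv_def, smul_smul, Ring.mul_inverse_cancel _ hpd.det_pos.ne'.isUnit, one_smul]
  rw [hadj]
  exact hpd.inv.smul hpd.det_pos

/-- The quadratic form of `Cᵀ adj(CCᵀ) C` is that of `adj(CCᵀ)` at `Cw`. -/
lemma dotProduct_transpose_mul_mul_mulVec {ι κ : Type*} [Fintype ι] [Fintype κ]
    (C : Matrix ι κ ℝ) (M : Matrix ι ι ℝ) (w : κ → ℝ) :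
    w ⬝ᵥ ((Cᵀ * M * C) *ᵥ w) = (C *ᵥ w) ⬝ᵥ (M *ᵥ (C *ᵥ w)) := by
  rw [← mulVec_mulVec, ← mulVec_mulVec, dotProduct_mulVec, vecMul_transpose]

lemma dotProduct_transpose_mul_adjugate_mul_nonneg {ι κ : Type*} [Fintype ι] [DecidableEq ι]
    [Fintype κ] (C : Matrix ι κ ℝ) (w : κ → ℝ) :
    0 ≤ w ⬝ᵥ ((Cᵀ * (C * Cᵀ).adjugate * C) *ᵥ w) := by
  by_cases hC : Function.Injective C.vecMul
  · rw [dotProduct_transpose_mul_mul_mulVec]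
    simpa using (posDef_adjugate_mul_transpose C hC).posSemidef.dotProduct_mulVec_nonneg (C *ᵥ w)
  · simp [Matrix.mul_assoc, adjugate_mul_self_eq_zero C hC]

lemma mulVec_eq_zero_of_dotProduct_adjugate_eq_zero {ι κ : Type*} [Fintype ι] [DecidableEq ι]
    [Fintype κ] (C : Matrix ι κ ℝ) (hC : Function.Injective C.vecMul) (w : κ → ℝ)
    (h : w ⬝ᵥ ((Cᵀ * (C * Cᵀ).adjugate * C) *ᵥ w) = 0) : C *ᵥ w = 0 := by
  by_contra hw
  rw [dotProduct_transpose_mul_mul_mulVec] at h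
  have hpos := (posDef_adjugate_mul_transpose C hC).dotProduct_mulVec_pos hw
  rw [star_trivial, h] at hpos
  exact lt_irrefl _ hpos

lemma principalAdj_mul_transpose {m n : ℕ} (A : Matrix (Fin m) (Fin n) ℝ) (S : Finset (Fin m)) :
    principalAdj (A * Aᵀ) S = (rowSub A S * (rowSub A S)ᵀ).adjugate := rfl

/-- A nonzero row belongs to a set of `k` independent rows, for each `1 ≤ k ≤ rank A`. -/
lemma exists_mem_card_eq_linearIndepOn_row {ι κ : Type*} [Fintype ι] [Fintype κ]
    (A : Matrix ι κ ℝ) {k : ℕ} (hk : 1 ≤ k) (hkr : k ≤ A.rank) {i : ι} (hi : A.row i ≠ 0) :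
    ∃ S : Finset ι, i ∈ S ∧ S.card = k ∧ LinearIndepOn ℝ A.row (S : Set ι) := by
  classical
  obtain ⟨b, -, hib, hspan, hb⟩ := exists_linearIndepOn_extension
    ((linearIndepOn_singleton_iff ℝ).2 hi) (Set.subset_univ {i})
  have hcard : A.rank ≤ b.toFinset.card := by
    have hb' := finrank_span_eq_card hb
    rw [Set.toFinset_card, ← hb', rank_eq_finrank_span_row]
    refine Submodule.finrank_mono (Submodule.span_le.2 ?_)
    rwa [← Set.image_univ, ← Set.image_eq_range]
  obtain ⟨S, hiS, hSb, hS⟩ := Finset.exists_subsuperset_card_eq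
    (s := {i}) (t := b.toFinset) (by simpa using hib) (by simpa using hk) (hkr.trans hcard)
  exact ⟨S, by simpa using hiS, hS, hb.mono fun x hx => by simpa using hSb hx⟩

/-- let `A` be a real `m × n` matrix of rank `r`, `B = A·Aᵀ`, and
`1 ≤ k' ≤ r`. With `N := Σ_{|S| = k'} (A_{S,:})ᵀ · adj(B_{S,S}) · A_{S,:}`, the kernel
of `N` equals the kernel of `A`: for every `w ∈ ℝⁿ`, `N·w = 0 ↔ A·w = 0`. -/
theorem stmt15 {m n r : ℕ} (A : Matrix (Fin m) (Fin n) ℝ) (hr : A.rank = r)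
    (k' : ℕ) (hk'1 : 1 ≤ k') (hk'r : k' ≤ r) (w : Fin n → ℝ) :
    (∑ S ∈ Finset.powersetCard k' (Finset.univ : Finset (Fin m)),
        (rowSub A S)ᵀ * principalAdj (A * Aᵀ) S * rowSub A S) *ᵥ w = 0
      ↔ A *ᵥ w = 0 := by
  have key (S : Finset (Fin m)) :
      0 ≤ w ⬝ᵥ (((rowSub A S)ᵀ * principalAdj (A * Aᵀ) S * rowSub A S) *ᵥ w) := by
    rw [principalAdj_mul_transpose]
    exact dotProduct_transpose_mul_adjugate_mul_nonneg _ w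
  constructor
  · intro h
    have hsum := congrArg (w ⬝ᵥ ·) h
    simp only [sum_mulVec, dotProduct_sum, dotProduct_zero] at hsum
    rw [Finset.sum_eq_zero_iff_of_nonneg fun S _ => key S] at hsum
    ext i
    by_cases hi : A.row i = 0
    · change A.row i ⬝ᵥ w = 0
      rw [hi, zero_dotProduct]
    obtain ⟨S, hiS, hS, hli⟩ := exists_mem_card_eq_linearIndepOn_row A hk'1 (hr ▸ hk'r) hi
    have hinj : Function.Injective (rowSub A S).vecMul := vecMul_injective_iff.2 hli
    have hS0 := hsum S (by simp [hS])
    rw [principalAdj_mul_transpose] at hS0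
    exact congrFun (mulVec_eq_zero_of_dotProduct_adjugate_eq_zero _ hinj w hS0) ⟨i, hiS⟩
  · intro h
    rw [sum_mulVec]
    refine Finset.sum_eq_zero fun S _ => ?_
    have hS : rowSub A S *ᵥ w = 0 := funext fun i => congrFun h i
    rw [← mulVec_mulVec, hS, mulVec_zero]
end
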